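/- For the natural representation of sl₃(ℂ) on the free Lie algebra L on a, b, c, there are no nonzero Lie invariants in degree 3 and no nonzero Lie invariants in degree 6. -/

import Mathlib

/-!
Setting: the free Lie algebra `FL` over ℂ on three generators `a < b < c`, with the
simple Lie algebra sl₃(ℂ) of traceless 3×3 complex matrices (standard basis
x₁ = E₁₂, x₂ = E₂₃, x₃ = E₁₃, h₁ = E₁₁−E₂₂, h₂ = E₂₂−E₃₃, y₁ = E₂₁, y₂ = E₃₂,
y₃ = E₃₁) acting on `FL` by derivations extending its natural representation on the
span of the generators (a, b, c are the standard basis column vectors e₁, e₂, e₃,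
acted on by matrix-vector multiplication):  x₁.b = a, x₂.c = b, x₃.c = a, h₁.a = a,
h₁.b = −b, h₂.b = b, h₂.c = −c, y₁.a = b, y₂.b = c, y₃.a = c, and all other actions of
these basis elements on the generators are zero.  The derivations realizing these
actions are determined by their values on the generators, so we quantify over
derivations with the prescribed generator values.
-/

noncomputable section

/-- The free Lie algebra over ℂ on three generators. -/
abbrev FL : Type := FreeLieAlgebra ℂ (Fin 3)

/-- The generator `a`. -/
def genA : FL := FreeLieAlgebra.of ℂ 0

/-- The generator `b`. -/
def genB : FL := FreeLieAlgebra.of ℂ 1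

/-- The generator `c`. -/
def genC : FL := FreeLieAlgebra.of ℂ 2

/-- Interpret a nonassociative word on the generators as a Lie monomial in `FL`. -/
def magmaToLie : FreeMagma (Fin 3) → FL
  | .of i => FreeLieAlgebra.of ℂ i
  | .mul t u => ⁅magmaToLie t, magmaToLie u⁆

/-- The homogeneous component `L_j`: the span of the Lie monomials of degree `j`. -/
def homog (j : ℕ) : Submodule ℂ FL :=
  Submodule.span ℂ (magmaToLie '' {t | t.length = j})

/-- The weight space `L_j^(w₁,w₂)`: the joint eigenspace of the `h₁`- and `h₂`-actions
on `L_j` with eigenvalues `w₁` and `w₂` respectively. -/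
def wtsp2 (H1 H2 : LieDerivation ℂ FL FL) (j : ℕ) (w1 w2 : ℤ) : Submodule ℂ FL :=
  homog j ⊓ Module.End.eigenspace (H1.toLinearMap) (w1 : ℂ) ⊓
    Module.End.eigenspace (H2.toLinearMap) (w2 : ℂ)

/-- The space of Lie invariants of degree `j`: elements of `L_j` annihilated by every
element of sl₃(ℂ), equivalently by the actions of the eight standard basis elements. -/
def invariants3 (X1 X2 X3 H1 H2 Y1 Y2 Y3 : LieDerivation ℂ FL FL) (j : ℕ) :
    Submodule ℂ FL :=
  homog j ⊓ LinearMap.ker X1.toLinearMap ⊓ LinearMap.ker X2.toLinearMap ⊓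
    LinearMap.ker X3.toLinearMap ⊓ LinearMap.ker H1.toLinearMap ⊓
    LinearMap.ker H2.toLinearMap ⊓ LinearMap.ker Y1.toLinearMap ⊓
    LinearMap.ker Y2.toLinearMap ⊓ LinearMap.ker Y3.toLinearMap

/-- The Lie subalgebra of `FL` generated by the invariants of degree `< j`.
An invariant of degree `j` is primitive iff it does not belong to this subalgebra. -/
def lowerInv3 (X1 X2 X3 H1 H2 Y1 Y2 Y3 : LieDerivation ℂ FL FL) (j : ℕ) :
    LieSubalgebra ℂ FL :=
  LieSubalgebra.lieSpan ℂ FL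
    (⋃ i < j, (invariants3 X1 X2 X3 H1 H2 Y1 Y2 Y3 i : Set FL))

attribute [local instance] LieRing.ofAssociativeRing

/-- The free associative algebra, modelled as a monoid algebra on words. -/
abbrev WA : Type := MonoidAlgebra ℂ (FreeMonoid (Fin 3))

/-- A word as an element of the free associative algebra. -/
def wd (l : List (Fin 3)) : WA := MonoidAlgebra.single (FreeMonoid.ofList l) 1

/-- Coefficient of a word. -/
def cf (p : WA) (l : List (Fin 3)) : ℂ := p.coeff (FreeMonoid.ofList l)

lemma wd_mul (l m : List (Fin 3)) : wd l * wd m = wd (l ++ m) := by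
  simp [wd, MonoidAlgebra.single_mul_single, FreeMonoid.ofList_append]

lemma wd_nil : wd [] = 1 := rfl

lemma cf_add (p q : WA) (l) : cf (p + q) l = cf p l + cf q l := by simp [cf]
lemma cf_sub (p q : WA) (l) : cf (p - q) l = cf p l - cf q l := by simp [cf]
lemma cf_smul (r : ℂ) (p : WA) (l) : cf (r • p) l = r * cf p l := by simp [cf]
lemma cf_zero (l) : cf 0 l = 0 := by simp [cf]

lemma cf_wd (l m : List (Fin 3)) : cf (wd l) m = if l = m then 1 else 0 := by
  classical
  rw [cf, wd, MonoidAlgebra.coeff_single, Finsupp.single_apply]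
  simp

lemma wa_ind {P : WA → Prop} (h1 : ∀ l, P (wd l)) (h0 : P 0) (ha : ∀ p q, P p → P q → P (p + q))
    (hs : ∀ (r : ℂ) p, P p → P (r • p)) (p : WA) : P p := by
  induction p using MonoidAlgebra.induction_on with
  | of m => exact h1 (FreeMonoid.toList m)
  | add p q hp hq => exact ha p q hp hq
  | smul r p hp => exact hs r p hp

/-- Linear extension from words. -/
def lin {M : Type} [AddCommGroup M] [Module ℂ M] (g : List (Fin 3) → M) : WA →ₗ[ℂ] M :=
  (Finsupp.linearCombination ℂ (fun w : FreeMonoid (Fin 3) => g (FreeMonoid.toList w))).comp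
    (MonoidAlgebra.coeffLinearEquiv ℂ).toLinearMap

lemma lin_wd {M : Type} [AddCommGroup M] [Module ℂ M] (g : List (Fin 3) → M) (l) :
    lin g (wd l) = g l := by
  simp [lin, wd]

/-- Derivation on words with prescribed values on letters. -/
def dw (g : Fin 3 → WA) : List (Fin 3) → WA
  | [] => 0
  | x :: l => g x * wd l + wd [x] * dw g l

/-- Derivation of the free associative algebra with prescribed values on letters. -/
def dA (g : Fin 3 → WA) : WA →ₗ[ℂ] WA := lin (dw g)

lemma dw_append (g) (l m : List (Fin 3)) :
    dw g (l ++ m) = dw g l * wd m + wd l * dw g m := by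
  induction l with
  | nil => simp [dw, wd_nil]
  | cons x l ih =>
    have e : wd (x :: l) = wd [x] * wd l := by rw [wd_mul]; rfl
    simp only [List.cons_append, dw, ih, ← wd_mul, e]
    noncomm_ring

lemma dA_mul (g) (p q : WA) : dA g (p * q) = dA g p * q + p * dA g q := by
  induction p using wa_ind with
  | h1 l =>
    induction q using wa_ind with
    | h1 m => simp only [wd_mul, dA, lin_wd, dw_append]
    | h0 => simp
    | ha p q hp hq => simp only [mul_add, map_add, hp, hq]; abel
    | hs r p hp => simp only [mul_smul_comm, map_smul, hp, smul_add]
  | h0 => simp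
  | ha p q hp hq => simp only [add_mul, map_add, hp, hq]; abel
  | hs r p hp => simp only [smul_mul_assoc, map_smul, hp, smul_add]

lemma dA_letter (g) (x : Fin 3) : dA g (wd [x]) = g x := by
  simp [dA, lin_wd, dw, wd_nil]

lemma dA_lie (g) (p q : WA) : dA g ⁅p, q⁆ = ⁅dA g p, q⁆ + ⁅p, dA g q⁆ := by
  simp only [LieRing.of_associative_ring_bracket, map_sub, dA_mul]
  abel

/-- The map from the free Lie algebra to the free associative algebra. -/
def emb : FL →ₗ⁅ℂ⁆ WA := FreeLieAlgebra.lift ℂ (fun i => wd [i])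

lemma emb_of (i : Fin 3) : emb (FreeLieAlgebra.of ℂ i) = wd [i] := by simp [emb]

lemma fm_ind {P : FreeMagma (Fin 3) → Prop} (h1 : ∀ i, P (.of i))
    (h2 : ∀ t u, P t → P u → P (.mul t u)) (t) : P t := by
  induction t with
  | ih1 i => exact h1 i
  | ih2 t u ht hu => exact h2 t u ht hu

lemma emb_der (X : LieDerivation ℂ FL FL) (g : Fin 3 → WA)
    (h : ∀ i, emb (X (FreeLieAlgebra.of ℂ i)) = g i) (t : FreeMagma (Fin 3)) :
    emb (X (magmaToLie t)) = dA g (emb (magmaToLie t)) := by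
  induction t using fm_ind with
  | h1 i => simp only [magmaToLie, h, emb_of, dA_letter]
  | h2 t u ht hu =>
    simp only [magmaToLie, LieDerivation.apply_lie_eq_add, map_add, LieHom.map_lie, ht, hu, dA_lie]
    abel

lemma homog_ind {n : ℕ} {P : ∀ z : FL, z ∈ homog n → Prop}
    (h1 : ∀ t : FreeMagma (Fin 3), (ht : t.length = n) → P (magmaToLie t) (Submodule.subset_span ⟨t, ht, rfl⟩))
    (h0 : P 0 (Submodule.zero_mem _))
    (ha : ∀ p q {hp hq}, P p hp → P q hq → P (p + q) (Submodule.add_mem _ hp hq))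
    (hs : ∀ (r : ℂ) p {hp}, P p hp → P (r • p) (Submodule.smul_mem _ r hp)) {z : FL}
    (hz : z ∈ homog n) : P z hz := by
  refine Submodule.span_induction ?_ h0 (fun _ _ _ _ h h' => ha _ _ h h')
    (fun r x _ h => hs r x h) hz
  rintro _ ⟨t, ht, rfl⟩
  exact h1 t ht

lemma emb_der_homog (X : LieDerivation ℂ FL FL) (g : Fin 3 → WA)
    (h : ∀ i, emb (X (FreeLieAlgebra.of ℂ i)) = g i) {n : ℕ} {z : FL} (hz : z ∈ homog n) :
    emb (X z) = dA g (emb z) := by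
  induction hz using homog_ind with
  | h1 t ht => exact emb_der X g h t
  | h0 => simp
  | ha p q hp hq => simp only [map_add, hp, hq]
  | hs r p hp => simp only [map_smul, hp]

/-! Diagonal derivations -/

/-- Values of a diagonal derivation. -/
def diag (s : Fin 3 → ℤ) : Fin 3 → WA := fun y => (s y : ℂ) • wd [y]

lemma dA_diag_wd (s) (l : List (Fin 3)) :
    dA (diag s) (wd l) = (((l.map s).sum : ℤ) : ℂ) • wd l := by
  rw [dA, lin_wd]
  induction l with
  | nil => simp [dw]
  | cons x l ih =>
    simp only [dw, ih, diag, List.map_cons, List.sum_cons, smul_mul_assoc, mul_smul_comm, wd_mul]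
    push_cast
    simp [add_smul]

lemma cf_diag (s) (p : WA) (l) :
    cf (dA (diag s) p) l = (((l.map s).sum : ℤ) : ℂ) * cf p l := by
  induction p using wa_ind with
  | h1 m =>
    rw [dA_diag_wd, cf_smul, cf_wd]
    split_ifs with h
    · rw [h]
    · simp
  | h0 => simp [cf_zero]
  | ha p q hp hq => simp only [map_add, cf_add, hp, hq]; ring
  | hs r p hp => simp only [map_smul, cf_smul, hp]; ring

lemma euler (t : FreeMagma (Fin 3)) :
    dA (diag fun _ => 1) (emb (magmaToLie t)) = (t.length : ℂ) • emb (magmaToLie t) := by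
  induction t using fm_ind with
  | h1 i => simp [magmaToLie, emb_of, dA_letter, diag, FreeMagma.length]
  | h2 t u ht hu =>
    have : (FreeMagma.mul t u).length = t.length + u.length := rfl
    simp only [magmaToLie, LieHom.map_lie, dA_lie, ht, hu, smul_lie, lie_smul, this]
    push_cast
    rw [add_smul]

lemma cf_length {n : ℕ} {z : FL} (hz : z ∈ homog n) (l : List (Fin 3)) (hl : l.length ≠ n) :
    cf (emb z) l = 0 := by
  induction hz using homog_ind with
  | h1 t ht =>
    have h := congrArg (fun p => cf p l) (euler t)
    simp only [cf_diag, cf_smul, ht] at h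
    simp only [List.map_const', List.sum_replicate] at h
    have h2 : ((l.length : ℂ) - n) * cf (emb (magmaToLie t)) l = 0 := by
      simp at h
      rcases h with h | h
      · exact absurd h hl
      · rw [h, mul_zero]
    rcases mul_eq_zero.1 h2 with h3 | h3
    · exact absurd (by exact_mod_cast sub_eq_zero.1 h3) hl
    · exact h3
  | h0 => simp [cf_zero]
  | ha p q hp hq => simp only [map_add, cf_add, hp, hq, add_zero]
  | hs r p hp => simp only [map_smul, cf_smul, hp, mul_zero]

/-! Elementary derivations -/

lemma cf_cons_nil (x : Fin 3) (p : WA) : cf (wd [x] * p) [] = 0 := by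
  induction p using wa_ind with
  | h1 m => rw [wd_mul, cf_wd]; simp
  | h0 => simp [cf_zero]
  | ha p q hp hq => simp only [mul_add, cf_add, hp, hq, add_zero]
  | hs r p hp => simp only [mul_smul_comm, cf_smul, hp, mul_zero]

lemma cf_cons_cons (x y : Fin 3) (p : WA) (l) :
    cf (wd [x] * p) (y :: l) = if x = y then cf p l else 0 := by
  induction p using wa_ind with
  | h1 m =>
    rw [wd_mul, cf_wd, cf_wd]
    by_cases h : x = y <;> simp [h]
  | h0 => simp [cf_zero]
  | ha p q hp hq =>
    simp only [mul_add, cf_add, hp, hq]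
    split_ifs <;> simp
  | hs r p hp =>
    simp only [mul_smul_comm, cf_smul, hp]
    split_ifs <;> simp

/-- All words obtained from a word by replacing one occurrence of `q` by `p`. -/
def subs (p q : Fin 3) : List (Fin 3) → List (List (Fin 3))
  | [] => []
  | x :: v => (if x = q then [p :: v] else []) ++ (subs p q v).map (x :: ·)

/-- Values of the derivation sending `p` to `q`. -/
def elem (p q : Fin 3) : Fin 3 → WA := fun y => if y = p then wd [q] else 0

/-- All words obtained by inserting a letter. -/
def ins (x : Fin 3) : List (Fin 3) → List (List (Fin 3))
  | [] => [[x]]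
  | y :: v => (x :: y :: v) :: (ins x v).map (y :: ·)

/-- Values of the derivation sending `x` to `1`. -/
def del (x : Fin 3) : Fin 3 → WA := fun y => if y = x then 1 else 0

lemma sum_map_cons (x y : Fin 3) (w : List (Fin 3)) (L : List (List (Fin 3))) :
    ((L.map (y :: ·)).map (cf (wd (x :: w)))).sum
      = if x = y then (L.map (cf (wd w))).sum else 0 := by
  induction L with
  | nil => simp
  | cons a L ih =>
    simp only [List.map_cons, List.sum_cons, ih, cf_wd]
    by_cases h : x = y <;> simp [h]

lemma sum_map_cons_nil (y : Fin 3) (L : List (List (Fin 3))) :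
    ((L.map (y :: ·)).map (cf (wd []))).sum = 0 := by
  induction L with
  | nil => simp
  | cons a L ih =>
    simp only [List.map_cons, List.sum_cons, ih, cf_wd]
    simp

lemma sum_map_lin {P : WA → WA} (hadd : ∀ p q, P (p + q) = P p + P q)
    (hsm : ∀ (r : ℂ) p, P (r • p) = r • P p) (v : List (Fin 3)) (L : List (List (Fin 3)))
    (h : ∀ w, cf (P (wd w)) v = (L.map (cf (wd w))).sum) (p : WA) :
    cf (P p) v = (L.map (cf p)).sum := by
  induction p using wa_ind with
  | h1 m => exact h m
  | h0 =>
    have : P 0 = 0 := by simpa using hsm 0 0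
    rw [this, cf_zero]
    have : cf 0 = fun _ => 0 := funext cf_zero
    simp [this]
  | ha p q hp hq =>
    have : cf (p + q) = fun l => cf p l + cf q l := funext (cf_add p q)
    rw [hadd, cf_add, hp, hq, this, List.sum_map_add]
  | hs r p hp =>
    have : cf (r • p) = fun l => r * cf p l := funext (cf_smul r p)
    rw [hsm, cf_smul, hp, this, List.sum_map_mul_left]

lemma cf_elem (p q : Fin 3) (T : WA) (v) :
    cf (dA (elem p q) T) v = ((subs p q v).map (cf T)).sum := by
  refine sum_map_lin (P := dA (elem p q)) (map_add _) (map_smul _) v _ ?_ T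
  intro w
  rw [dA, lin_wd]
  induction v generalizing w with
  | nil =>
    cases w with
    | nil => simp [dw, subs, cf_zero]
    | cons x w =>
      simp only [dw, cf_add, cf_cons_nil, subs, elem]
      split_ifs <;> simp [cf_cons_nil, cf_zero]
  | cons y v ih =>
    simp only [subs, List.map_append, List.sum_append]
    cases w with
    | nil =>
      rw [sum_map_cons_nil]
      simp only [dw, cf_zero]
      split_ifs <;> simp [cf_wd]
    | cons x w =>
      rw [sum_map_cons]
      simp only [dw, cf_add, cf_cons_cons, ih, elem]
      congr 1
      by_cases h1 : x = p
      · by_cases h2 : y = q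
        · simp [h1, h2, cf_cons_cons, cf_wd]
        · simp [h1, h2, cf_cons_cons, Ne.symm h2]
      · by_cases h2 : y = q <;> simp [h1, h2, cf_wd, cf_zero]

lemma cf_del (x : Fin 3) (T : WA) (v) :
    cf (dA (del x) T) v = ((ins x v).map (cf T)).sum := by
  refine sum_map_lin (P := dA (del x)) (map_add _) (map_smul _) v _ ?_ T
  intro w
  rw [dA, lin_wd]
  induction v generalizing w with
  | nil =>
    cases w with
    | nil => simp [dw, ins, cf_zero, cf_wd]
    | cons y w =>
      simp only [dw, cf_add, cf_cons_nil, ins, del]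
      by_cases h : y = x <;> simp [h, cf_wd, cf_zero]
  | cons y v ih =>
    simp only [ins, List.map_cons, List.sum_cons]
    cases w with
    | nil =>
      rw [sum_map_cons_nil]
      simp [dw, cf_zero, cf_wd]
    | cons z w =>
      rw [sum_map_cons]
      simp only [dw, cf_add, cf_cons_cons, ih, del]
      congr 1
      by_cases h : z = x <;> simp [h, cf_wd, cf_zero]

lemma del_scalar (x : Fin 3) (t : FreeMagma (Fin 3)) :
    ∃ r : ℂ, dA (del x) (emb (magmaToLie t)) = r • 1 ∧ (2 ≤ t.length → r = 0) := by
  induction t using fm_ind with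
  | h1 i =>
    refine ⟨if i = x then 1 else 0, ?_, ?_⟩
    · simp only [magmaToLie, emb_of, dA_letter, del]
      split_ifs <;> simp
    · intro h; simp [FreeMagma.length] at h
  | h2 t u ht hu =>
    obtain ⟨r, hr, -⟩ := ht
    obtain ⟨s, hs, -⟩ := hu
    refine ⟨0, ?_, fun _ => rfl⟩
    simp only [magmaToLie, LieHom.map_lie, dA_lie, hr, hs]
    simp [LieRing.of_associative_ring_bracket]

lemma ins_zero {n : ℕ} (hn : 2 ≤ n) {z : FL} (hz : z ∈ homog n) (x : Fin 3) (v) :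
    ((ins x v).map (cf (emb z))).sum = 0 := by
  rw [← cf_del]
  suffices h : dA (del x) (emb z) = 0 by rw [h, cf_zero]
  induction hz using homog_ind with
  | h1 t ht =>
    obtain ⟨r, hr, h0⟩ := del_scalar x t
    rw [hr, h0 (ht ▸ hn), zero_smul]
  | h0 => simp
  | ha p q hp hq => simp only [map_add, hp, hq, add_zero]
  | hs r p hp => simp only [map_smul, hp, smul_zero]

/-! Reversal -/

/-- The antipode. -/
def anti : WA →ₗ[ℂ] WA := lin (fun w => ((-1 : ℂ) ^ w.length) • wd w.reverse)

lemma anti_mul (p q : WA) : anti (p * q) = anti q * anti p := by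
  induction p using wa_ind with
  | h1 l =>
    induction q using wa_ind with
    | h1 m =>
      simp only [wd_mul, anti, lin_wd, smul_mul_assoc, mul_smul_comm, smul_smul,
        List.reverse_append, List.length_append, pow_add]
    | h0 => simp
    | ha p q hp hq => simp only [mul_add, add_mul, map_add, hp, hq]
    | hs r p hp => simp only [mul_smul_comm, smul_mul_assoc, map_smul, hp]
  | h0 => simp
  | ha p q hp hq => simp only [mul_add, add_mul, map_add, hp, hq]
  | hs r p hp => simp only [mul_smul_comm, smul_mul_assoc, map_smul, hp]

lemma anti_emb (t : FreeMagma (Fin 3)) : anti (emb (magmaToLie t)) = - emb (magmaToLie t) := by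
  induction t using fm_ind with
  | h1 i => simp [magmaToLie, emb_of, anti, lin_wd]
  | h2 t u ht hu =>
    simp only [magmaToLie, LieHom.map_lie, LieRing.of_associative_ring_bracket, map_sub, anti_mul,
      ht, hu]
    noncomm_ring

lemma cf_anti (p : WA) (l) : cf (anti p) l = (-1 : ℂ) ^ l.length * cf p l.reverse := by
  induction p using wa_ind with
  | h1 m =>
    rw [anti, lin_wd, cf_smul, cf_wd, cf_wd]
    by_cases h : m = l.reverse
    · simp [h]
    · have : m.reverse ≠ l := fun h' => h (by rw [← h', List.reverse_reverse])
      simp [h, this]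
  | h0 => simp [cf_zero]
  | ha p q hp hq => simp only [map_add, cf_add, hp, hq]; ring
  | hs r p hp => simp only [map_smul, cf_smul, hp]; ring

lemma cf_reverse {n : ℕ} {z : FL} (hz : z ∈ homog n) (l : List (Fin 3)) :
    (-1 : ℂ) ^ l.length * cf (emb z) l.reverse + cf (emb z) l = 0 := by
  rw [← cf_anti, ← cf_add]
  suffices h : anti (emb z) + emb z = 0 by rw [h, cf_zero]
  induction hz using homog_ind with
  | h1 t ht => rw [anti_emb]; simp
  | h0 => simp
  | ha p q hp hq =>
    have : anti (emb (p + q)) + emb (p + q) = (anti (emb p) + emb p) + (anti (emb q) + emb q) := by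
      simp only [map_add]; abel
    rw [this, hp, hq, add_zero]
  | hs r p hp =>
    have : anti (emb (r • p)) + emb (r • p) = r • (anti (emb p) + emb p) := by
      simp only [map_smul, smul_add]
    rw [this, hp, smul_zero]

/-! Dynkin operator -/

/-- Right-normed bracketing of a word. -/
def dynw : List (Fin 3) → FL
  | [] => 0
  | [x] => FreeLieAlgebra.of ℂ x
  | x :: y :: l => ⁅(FreeLieAlgebra.of ℂ x : FL), dynw (y :: l)⁆

/-- The Dynkin operator. -/
def dyn : WA →ₗ[ℂ] FL := lin dynw

/-- Action of the free associative algebra on the free Lie algebra. -/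
def adA : WA →ₐ[ℂ] Module.End ℂ FL :=
  MonoidAlgebra.lift ℂ _ _
    (FreeMonoid.lift fun i => (LieAlgebra.ad ℂ FL (FreeLieAlgebra.of ℂ i) : Module.End ℂ FL))

lemma adA_wd_cons (x) (l) (z : FL) :
    adA (wd (x :: l)) z = ⁅(FreeLieAlgebra.of ℂ x : FL), adA (wd l) z⁆ := by
  have e : wd (x :: l) = wd [x] * wd l := by rw [wd_mul]; rfl
  have e2 : adA (wd [x]) = LieAlgebra.ad ℂ FL (FreeLieAlgebra.of ℂ x) := by
    simp [adA, wd]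
  rw [e, map_mul, e2]
  simp

lemma adA_emb (t : FreeMagma (Fin 3)) : adA (emb (magmaToLie t)) = LieAlgebra.ad ℂ FL (magmaToLie t) := by
  induction t using fm_ind with
  | h1 i =>
    ext z
    rw [magmaToLie, emb_of, adA_wd_cons, wd_nil, map_one]
    simp
  | h2 t u ht hu =>
    simp only [magmaToLie, LieHom.map_lie, LieRing.of_associative_ring_bracket, map_sub, map_mul,
      ht, hu]

lemma dynw_append (l m : List (Fin 3)) :
    dynw (l ++ m) = adA (wd l) (dynw m) + (if m = [] then dynw l else 0) := by
  induction l with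
  | nil => simp [wd_nil, dynw]
  | cons x l ih =>
    rw [adA_wd_cons]
    cases l with
    | nil =>
      cases m with
      | nil => simp [dynw]
      | cons y m => simp [dynw, wd_nil]
    | cons y l =>
      rw [List.cons_append, List.cons_append, dynw, ← List.cons_append, ih, lie_add]
      split_ifs <;> simp [dynw]

lemma dyn_mul (p q : WA) : dyn (p * q) = adA p (dyn q) + cf q [] • dyn p := by
  induction p using wa_ind with
  | h1 l =>
    induction q using wa_ind with
    | h1 m =>
      simp only [wd_mul, dyn, lin_wd, dynw_append, cf_wd]
      split_ifs <;> simp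
    | h0 => simp [cf_zero]
    | ha p q hp hq => simp only [mul_add, map_add, hp, hq, cf_add, add_smul]; abel
    | hs r p hp => simp only [mul_smul_comm, map_smul, hp, cf_smul, smul_add, mul_smul]
  | h0 => simp
  | ha p q hp hq => simp only [add_mul, map_add, hp, hq, LinearMap.add_apply, smul_add]; abel
  | hs r p hp =>
    simp only [smul_mul_assoc, map_smul, hp, smul_add, LinearMap.smul_apply]
    rw [smul_comm]

lemma cf_emb_nil (t : FreeMagma (Fin 3)) : cf (emb (magmaToLie t)) [] = 0 :=
  cf_length (n := t.length) (Submodule.subset_span ⟨t, rfl, rfl⟩) [] t.length_pos.ne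

lemma dyn_emb (t : FreeMagma (Fin 3)) :
    dyn (emb (magmaToLie t)) = (t.length : ℂ) • magmaToLie t := by
  induction t using fm_ind with
  | h1 i => simp [magmaToLie, emb_of, dyn, lin_wd, dynw, FreeMagma.length]
  | h2 t u ht hu =>
    have : (FreeMagma.mul t u).length = t.length + u.length := rfl
    simp only [magmaToLie, LieHom.map_lie, LieRing.of_associative_ring_bracket, map_sub, dyn_mul,
      adA_emb, ht, hu, cf_emb_nil, zero_smul, add_zero, LieAlgebra.ad_apply, lie_smul, this]
    rw [← lie_skew (magmaToLie t) (magmaToLie u)]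
    push_cast
    module

lemma emb_inj {n : ℕ} (hn : n ≠ 0) {z : FL} (hz : z ∈ homog n) (h : ∀ l, cf (emb z) l = 0) :
    z = 0 := by
  have h0 : emb z = 0 := by
    apply MonoidAlgebra.ext
    ext l
    exact h (FreeMonoid.toList l)
  have h1 : dyn (emb z) = (n : ℂ) • z := by
    clear h h0
    induction hz using homog_ind with
    | h1 t ht => rw [dyn_emb, ht]
    | h0 => simp
    | ha p q hp hq => simp only [map_add, hp, hq, smul_add]
    | hs r p hp => simp only [map_smul, hp]; rw [smul_comm]
  rw [h0, map_zero] at h1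
  exact (smul_eq_zero.1 h1.symm).resolve_left (by exact_mod_cast hn)

/-- The words of content `(2,2,2)`. -/
def words222 : List (List (Fin 3)) :=
  [[0,0,1,1,2,2], [0,0,1,2,1,2], [0,0,1,2,2,1], [0,0,2,1,1,2], [0,0,2,1,2,1], [0,0,2,2,1,1],
   [0,1,0,1,2,2], [0,1,0,2,1,2], [0,1,0,2,2,1], [0,1,1,0,2,2], [0,1,1,2,0,2], [0,1,1,2,2,0],
   [0,1,2,0,1,2], [0,1,2,0,2,1], [0,1,2,1,0,2], [0,1,2,1,2,0], [0,1,2,2,0,1], [0,1,2,2,1,0],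
   [0,2,0,1,1,2], [0,2,0,1,2,1], [0,2,0,2,1,1], [0,2,1,0,1,2], [0,2,1,0,2,1], [0,2,1,1,0,2],
   [0,2,1,1,2,0], [0,2,1,2,0,1], [0,2,1,2,1,0], [0,2,2,0,1,1], [0,2,2,1,0,1], [0,2,2,1,1,0],
   [1,0,0,1,2,2], [1,0,0,2,1,2], [1,0,0,2,2,1], [1,0,1,0,2,2], [1,0,1,2,0,2], [1,0,1,2,2,0],
   [1,0,2,0,1,2], [1,0,2,0,2,1], [1,0,2,1,0,2], [1,0,2,1,2,0], [1,0,2,2,0,1], [1,0,2,2,1,0],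
   [1,1,0,0,2,2], [1,1,0,2,0,2], [1,1,0,2,2,0], [1,1,2,0,0,2], [1,1,2,0,2,0], [1,1,2,2,0,0],
   [1,2,0,0,1,2], [1,2,0,0,2,1], [1,2,0,1,0,2], [1,2,0,1,2,0], [1,2,0,2,0,1], [1,2,0,2,1,0],
   [1,2,1,0,0,2], [1,2,1,0,2,0], [1,2,1,2,0,0], [1,2,2,0,0,1], [1,2,2,0,1,0], [1,2,2,1,0,0],
   [2,0,0,1,1,2], [2,0,0,1,2,1], [2,0,0,2,1,1], [2,0,1,0,1,2], [2,0,1,0,2,1], [2,0,1,1,0,2],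
   [2,0,1,1,2,0], [2,0,1,2,0,1], [2,0,1,2,1,0], [2,0,2,0,1,1], [2,0,2,1,0,1], [2,0,2,1,1,0],
   [2,1,0,0,1,2], [2,1,0,0,2,1], [2,1,0,1,0,2], [2,1,0,1,2,0], [2,1,0,2,0,1], [2,1,0,2,1,0],
   [2,1,1,0,0,2], [2,1,1,0,2,0], [2,1,1,2,0,0], [2,1,2,0,0,1], [2,1,2,0,1,0], [2,1,2,1,0,0],
   [2,2,0,0,1,1], [2,2,0,1,0,1], [2,2,0,1,1,0], [2,2,1,0,0,1], [2,2,1,0,1,0], [2,2,1,1,0,0]]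

lemma core6 (c : List (Fin 3) → ℂ) (hr : ∀ w, w.length = 6 → c w.reverse + c w = 0)
    (hs : ∀ p q v, p ≠ q → ((subs p q v).map c).sum = 0)
    (hd : ∀ x v, ((ins x v).map c).sum = 0) : ∀ w ∈ words222, c w = 0 := by
  have e0 : c [2,1,0,0,1,2] = 0 := by
    have r : c [2,1,0,0,1,2] + c [2,1,0,0,1,2] = 0 := hr [2,1,0,0,1,2] rfl
    linear_combination (1 / 2) * (r)
  have e1 : c [1,0,2,2,0,1] = 0 := by
    have r : c [1,0,2,2,0,1] + c [1,0,2,2,0,1] = 0 := hr [1,0,2,2,0,1] rfl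
    linear_combination (1 / 2) * (r)
  have e2 : c [0,1,2,2,1,0] = 0 := by
    have r : c [0,1,2,2,1,0] + c [0,1,2,2,1,0] = 0 := hr [0,1,2,2,1,0] rfl
    linear_combination (1 / 2) * (r)
  have e3 : c [0,2,1,1,2,0] = 0 := by
    have r : c [0,2,1,1,2,0] + c [0,2,1,1,2,0] = 0 := hr [0,2,1,1,2,0] rfl
    linear_combination (1 / 2) * (r)
  have e4 : c [2,0,1,1,0,2] = 0 := by
    have r : c [2,0,1,1,0,2] + c [2,0,1,1,0,2] = 0 := hr [2,0,1,1,0,2] rfl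
    linear_combination (1 / 2) * (r)
  have e5 : c [1,2,0,0,2,1] = 0 := by
    have r : c [1,2,0,0,2,1] + c [1,2,0,0,2,1] = 0 := hr [1,2,0,0,2,1] rfl
    linear_combination (1 / 2) * (r)
  have e6 : c [0,1,2,0,2,1] = (-1) * c [1,2,0,2,1,0] := by
    have r : c [1,2,0,2,1,0] + c [0,1,2,0,2,1] = 0 := hr [0,1,2,0,2,1] rfl
    linear_combination r
  have e7 : c [1,1,2,2,0,0] = (-1) * c [0,1,2,2,0,1] := by
    have r : c [1,1,2,2,0,0] + (c [0,1,2,2,1,0] + (c [0,1,2,2,0,1] + 0)) = 0 :=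
      hs 1 0 [0,1,2,2,0,0] (by decide)
    linear_combination r - e2
  have e8 : c [0,0,2,2,1,1] = (-1) * c [0,1,2,2,0,1] := by
    have r : c [0,0,2,2,1,1] + (c [0,1,2,2,0,1] + (c [0,1,2,2,1,0] + 0)) = 0 :=
      hs 0 1 [0,1,2,2,1,1] (by decide)
    linear_combination r - e2
  have e9 : c [1,0,2,2,1,0] = c [0,1,2,2,0,1] := by
    have r : c [0,1,2,2,1,0] + (c [1,0,2,2,1,0] + (c [1,1,2,2,0,0] + 0)) = 0 :=
      hs 0 1 [1,1,2,2,1,0] (by decide)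
    linear_combination r - e2 - e7
  have e10 : c [0,1,0,2,2,1] = c [1,2,0,2,1,0] + (-1) * c [0,1,2,2,0,1] := by
    have r : c [0,1,0,2,2,1] + (c [0,1,2,0,2,1] + (c [0,1,2,2,0,1] + 0)) = 0 :=
      hs 0 2 [0,1,2,2,2,1] (by decide)
    linear_combination r - e6
  have e11 : c [1,0,0,2,1,2] = (-1) * c [1,2,0,2,1,0] + (-1) * c [0,1,2,2,0,1] := by
    have r : c [1,2,0,2,1,0] + (c [1,0,2,2,1,0] + (c [1,0,0,2,1,2] + 0)) = 0 :=
      hs 2 0 [1,0,0,2,1,0] (by decide)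
    linear_combination r - e9
  have e12 : c [2,1,0,2,0,1] = (-1) * c [1,2,0,2,1,0] := by
    have r : c [2,1,0,2,0,1] + (c [0,1,2,2,0,1] + (c [0,1,0,2,2,1] + 0)) = 0 :=
      hs 2 0 [0,1,0,2,0,1] (by decide)
    linear_combination r - e10
  have e13 : c [2,1,2,0,0,1] = c [1,2,0,2,1,0] + c [0,1,2,2,0,1] := by
    have r : c [1,0,0,2,1,2] + c [2,1,2,0,0,1] = 0 := hr [2,1,2,0,0,1] rfl
    linear_combination r - e11
  have e14 : c [0,0,1,2,2,1] = 0 := by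
    have r : c [0,0,1,2,2,1] + (c [0,0,1,2,2,1] + (c [0,1,0,2,2,1] + (c [0,1,2,0,2,1] + (c [0,1,2,2,0,1] + (c [0,1,2,2,1,0] + 0))))) = 0 :=
      hd 0 [0,1,2,2,1]
    linear_combination (1 / 2) * (r - e10 - e6 - e2)
  have e15 : c [1,0,2,0,1,2] = c [1,2,0,2,1,0] := by
    have r : c [2,1,0,2,0,1] + c [1,0,2,0,1,2] = 0 := hr [1,0,2,0,1,2] rfl
    linear_combination r - e12
  have e16 : c [1,2,2,0,1,0] = (-1) * c [1,2,0,2,1,0] + c [0,1,2,2,0,1] := by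
    have r : c [0,1,0,2,2,1] + c [1,2,2,0,1,0] = 0 := hr [1,2,2,0,1,0] rfl
    linear_combination r - e10
  have e17 : c [1,2,0,0,1,2] = (-1) * c [0,1,2,2,0,1] := by
    have r : c [1,0,2,0,1,2] + (c [1,2,0,0,1,2] + (c [1,2,2,0,1,0] + 0)) = 0 :=
      hs 0 2 [1,2,2,0,1,2] (by decide)
    linear_combination r - e15 - e16
  have e18 : c [2,1,0,0,2,1] = c [0,1,2,2,0,1] := by
    have r : c [2,1,0,0,2,1] + c [1,2,0,0,1,2] = 0 := hr [1,2,0,0,1,2] rfl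
    linear_combination r - e17
  have e19 : c [2,2,1,0,0,1] = (-1) * c [0,1,2,2,0,1] := by
    have r : c [2,2,1,0,0,1] + (c [2,2,1,0,0,1] + (c [2,1,2,0,0,1] + (c [2,1,0,2,0,1] + (c [2,1,0,0,2,1] + (c [2,1,0,0,1,2] + 0))))) = 0 :=
      hd 2 [2,1,0,0,1]
    linear_combination (1 / 2) * (r - e13 - e12 - e18 - e0)
  have e20 : c [0,0,1,2,1,2] = c [0,1,2,2,0,1] := by
    have r : c [0,0,2,2,1,1] + (c [0,0,1,2,2,1] + (c [0,0,1,2,1,2] + 0)) = 0 :=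
      hs 2 1 [0,0,1,2,1,1] (by decide)
    linear_combination r - e8 - e14
  have e21 : c [2,1,1,0,0,2] = (-1) * c [1,2,0,2,1,0] := by
    have r : c [2,2,1,0,0,1] + (c [2,1,2,0,0,1] + (c [2,1,1,0,0,2] + 0)) = 0 :=
      hs 2 1 [2,1,1,0,0,1] (by decide)
    linear_combination r - e19 - e13
  have e22 : c [0,0,1,1,2,2] = (-1) * c [0,1,2,2,0,1] := by
    have r : c [0,0,1,1,2,2] + (c [0,0,1,2,1,2] + (c [0,0,1,2,2,1] + 0)) = 0 :=
      hs 1 2 [0,0,1,2,2,2] (by decide)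
    linear_combination r - e20 - e14
  have e23 : c [2,2,0,0,1,1] = c [0,1,2,2,0,1] := by
    have r : c [2,2,0,0,1,1] + (c [1,2,0,0,2,1] + (c [1,2,0,0,1,2] + 0)) = 0 :=
      hs 2 1 [1,2,0,0,1,1] (by decide)
    linear_combination r - e5 - e17
  have e24 : c [1,1,0,0,2,2] = (-1) * c [0,1,2,2,0,1] := by
    have r : c [2,2,0,0,1,1] + c [1,1,0,0,2,2] = 0 := hr [1,1,0,0,2,2] rfl
    linear_combination r - e23
  have e25 : c [2,2,1,0,1,0] = 0 := by
    have r : c [2,2,0,0,1,1] + (c [2,2,1,0,0,1] + (c [2,2,1,0,1,0] + 0)) = 0 :=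
      hs 0 1 [2,2,1,0,1,1] (by decide)
    linear_combination r - e23 - e19
  have e26 : c [2,2,1,1,0,0] = c [0,1,2,2,0,1] := by
    have r : c [0,0,1,1,2,2] + c [2,2,1,1,0,0] = 0 := hr [2,2,1,1,0,0] rfl
    linear_combination r - e22
  have e27 : c [2,0,1,1,2,0] = c [0,1,2,2,0,1] := by
    have r : c [0,0,1,1,2,2] + (c [2,0,1,1,0,2] + (c [2,0,1,1,2,0] + 0)) = 0 :=
      hs 0 2 [2,0,1,1,2,2] (by decide)
    linear_combination r - e22 - e4
  have e28 : c [0,1,0,1,2,2] = 0 := by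
    have r : c [2,2,1,0,1,0] + c [0,1,0,1,2,2] = 0 := hr [0,1,0,1,2,2] rfl
    linear_combination r - e25
  have e29 : c [1,0,0,1,2,2] = c [0,1,2,2,0,1] := by
    have r : c [1,0,0,1,2,2] + c [2,2,1,0,0,1] = 0 := hr [2,2,1,0,0,1] rfl
    linear_combination r - e19
  have e30 : c [0,2,1,1,0,2] = (-1) * c [0,1,2,2,0,1] := by
    have r : c [0,2,1,1,0,2] + c [2,0,1,1,2,0] = 0 := hr [2,0,1,1,2,0] rfl
    linear_combination r - e27
  have e31 : c [1,2,1,0,2,0] = c [1,2,0,2,1,0] + (-1) * c [0,1,2,2,0,1] := by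
    have r : c [2,2,1,0,1,0] + (c [1,2,2,0,1,0] + (c [1,2,1,0,2,0] + 0)) = 0 :=
      hs 2 1 [1,2,1,0,1,0] (by decide)
    linear_combination r - e25 - e16
  have e32 : c [2,2,0,1,0,1] = 0 := by
    have r : c [2,2,1,0,0,1] + (c [2,2,0,1,0,1] + (c [2,2,0,0,1,1] + 0)) = 0 :=
      hs 1 0 [2,2,0,0,0,1] (by decide)
    linear_combination r - e19 - e23
  have e33 : c [0,0,2,1,1,2] = 0 := by
    have r : c [0,0,1,2,1,2] + (c [0,0,2,1,1,2] + (c [0,0,2,2,1,1] + 0)) = 0 :=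
      hs 1 2 [0,0,2,2,1,2] (by decide)
    linear_combination r - e20 - e8
  have e34 : c [0,2,0,1,2,1] = (-1) * c [1,2,0,2,1,0] + c [0,1,2,2,0,1] := by
    have r : c [0,2,0,1,2,1] + c [1,2,1,0,2,0] = 0 := hr [1,2,1,0,2,0] rfl
    linear_combination r - e31
  have e35 : c [1,0,0,2,2,1] = c [1,2,0,2,1,0] := by
    have r : c [1,0,0,1,2,2] + (c [1,0,0,2,1,2] + (c [1,0,0,2,2,1] + 0)) = 0 :=
      hs 1 2 [1,0,0,2,2,2] (by decide)
    linear_combination r - e29 - e11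
  have e36 : c [1,2,1,0,0,2] = c [1,2,0,2,1,0] + c [0,1,2,2,0,1] := by
    have r : c [1,2,1,0,0,2] + (c [2,1,1,0,0,2] + (c [2,2,1,0,0,1] + 0)) = 0 :=
      hs 1 2 [2,2,1,0,0,2] (by decide)
    linear_combination r - e21 - e19
  have e37 : c [2,1,1,2,0,0] = 0 := by
    have r : c [0,0,2,1,1,2] + c [2,1,1,2,0,0] = 0 := hr [2,1,1,2,0,0] rfl
    linear_combination r - e33
  have e38 : c [0,0,2,1,2,1] = c [0,1,2,2,0,1] := by
    have r : c [0,0,2,2,1,1] + (c [0,0,2,1,2,1] + (c [0,0,2,1,1,2] + 0)) = 0 :=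
      hs 2 1 [0,0,2,1,1,1] (by decide)
    linear_combination r - e8 - e33
  have e39 : c [1,2,2,0,0,1] = (-1) * c [1,2,0,2,1,0] := by
    have r : c [1,2,2,0,0,1] + (c [2,1,2,0,0,1] + (c [2,2,1,0,0,1] + 0)) = 0 :=
      hs 1 2 [2,2,2,0,0,1] (by decide)
    linear_combination r - e13 - e19
  have e40 : c [1,2,0,1,2,0] = c [1,2,0,2,1,0] + (-1) * c [0,1,2,2,0,1] := by
    have r : c [0,2,0,1,2,1] + (c [1,2,0,0,2,1] + (c [1,2,0,1,2,0] + 0)) = 0 :=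
      hs 0 1 [1,2,0,1,2,1] (by decide)
    linear_combination r - e34 - e5
  have e41 : c [2,0,0,1,2,1] = c [1,2,0,2,1,0] + (-1) * c [0,1,2,2,0,1] := by
    have r : c [0,2,0,1,2,1] + (c [2,0,0,1,2,1] + (c [2,2,0,1,0,1] + 0)) = 0 :=
      hs 0 2 [2,2,0,1,2,1] (by decide)
    linear_combination r - e34 - e32
  have e42 : c [0,1,1,2,2,0] = (-1) * c [1,2,0,2,1,0] + c [0,1,2,2,0,1] := by
    have r : c [0,0,1,2,2,1] + (c [0,1,0,2,2,1] + (c [0,1,1,2,2,0] + 0)) = 0 :=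
      hs 0 1 [0,1,1,2,2,1] (by decide)
    linear_combination r - e14 - e10
  have e43 : c [2,0,0,2,1,1] = (-2) * c [1,2,0,2,1,0] + c [0,1,2,2,0,1] := by
    have r : c [1,0,0,2,2,1] + (c [2,0,0,1,2,1] + (c [2,0,0,2,1,1] + 0)) = 0 :=
      hs 1 2 [2,0,0,2,2,1] (by decide)
    linear_combination r - e35 - e41
  have e44 : c [1,0,2,1,0,2] = (-1) * c [1,2,0,2,1,0] := by
    have r : c [0,0,2,1,1,2] + (c [1,0,2,0,1,2] + (c [1,0,2,1,0,2] + 0)) = 0 :=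
      hs 0 1 [1,0,2,1,1,2] (by decide)
    linear_combination r - e33 - e15
  have e45 : c [0,2,1,0,2,1] = (-1) * c [1,2,0,2,1,0] + c [0,1,2,2,0,1] := by
    have r : c [0,2,1,0,2,1] + (c [1,2,0,0,2,1] + (c [1,2,1,0,2,0] + 0)) = 0 :=
      hs 0 1 [1,2,1,0,2,1] (by decide)
    linear_combination r - e5 - e31
  have e46 : c [2,1,0,2,1,0] = (3) * c [1,2,0,2,1,0] + (-1) * c [0,1,2,2,0,1] := by
    have r : c [2,0,0,2,1,1] + (c [2,1,0,2,0,1] + (c [2,1,0,2,1,0] + 0)) = 0 :=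
      hs 0 1 [2,1,0,2,1,1] (by decide)
    linear_combination r - e43 - e12
  have e47 : c [1,2,0,2,0,1] = (-1) * c [1,2,0,2,1,0] := by
    have r : c [1,2,0,2,0,1] + (c [1,0,2,2,0,1] + (c [1,0,0,2,2,1] + 0)) = 0 :=
      hs 2 0 [1,0,0,2,0,1] (by decide)
    linear_combination r - e1 - e35
  have e48 : c [1,2,2,1,0,0] = 0 := by
    have r : c [1,2,2,1,0,0] + c [0,0,1,2,2,1] = 0 := hr [0,0,1,2,2,1] rfl
    linear_combination r - e14
  have e49 : c [1,0,1,0,2,2] = 0 := by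
    have r : c [2,2,0,1,0,1] + c [1,0,1,0,2,2] = 0 := hr [1,0,1,0,2,2] rfl
    linear_combination r - e32
  have e50 : c [2,2,0,1,1,0] = (-2) * c [1,2,0,2,1,0] + c [0,1,2,2,0,1] := by
    have r : c [2,2,0,1,1,0] + (c [1,2,0,2,1,0] + (c [1,2,0,1,2,0] + 0)) = 0 :=
      hs 2 1 [1,2,0,1,1,0] (by decide)
    linear_combination r - e40
  have e51 : c [0,1,0,2,1,2] = (-1) * c [1,2,0,2,1,0] + c [0,1,2,2,0,1] := by
    have r : c [0,1,0,1,2,2] + (c [0,1,0,2,1,2] + (c [0,1,0,2,2,1] + 0)) = 0 :=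
      hs 1 2 [0,1,0,2,2,2] (by decide)
    linear_combination r - e28 - e10
  have e52 : c [1,0,2,1,2,0] = (-1) * c [1,2,0,2,1,0] := by
    have r : c [1,2,0,1,2,0] + (c [1,0,2,1,2,0] + (c [1,0,0,1,2,2] + 0)) = 0 :=
      hs 2 0 [1,0,0,1,2,0] (by decide)
    linear_combination r - e40 - e29
  have e53 : c [2,1,0,1,2,0] = (-1) * c [1,2,0,2,1,0] := by
    have r : c [2,1,0,1,2,0] + (c [2,0,1,1,2,0] + (c [2,0,0,1,2,1] + 0)) = 0 :=
      hs 1 0 [2,0,0,1,2,0] (by decide)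
    linear_combination r - e27 - e41
  have e54 : c [2,1,1,0,2,0] = c [1,2,0,2,1,0] + (-1) * c [0,1,2,2,0,1] := by
    have r : c [2,0,1,1,2,0] + (c [2,1,0,1,2,0] + (c [2,1,1,0,2,0] + 0)) = 0 :=
      hs 0 1 [2,1,1,1,2,0] (by decide)
    linear_combination r - e27 - e53
  have e55 : c [1,2,0,1,0,2] = (-1) * c [1,2,0,2,1,0] := by
    have r : c [1,0,0,1,2,2] + (c [1,2,0,1,0,2] + (c [1,2,0,1,2,0] + 0)) = 0 :=
      hs 0 2 [1,2,0,1,2,2] (by decide)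
    linear_combination r - e29 - e40
  have e56 : c [2,1,2,0,1,0] = c [1,2,0,2,1,0] + (-1) * c [0,1,2,2,0,1] := by
    have r : c [0,1,0,2,1,2] + c [2,1,2,0,1,0] = 0 := hr [2,1,2,0,1,0] rfl
    linear_combination r - e51
  have e57 : c [1,0,2,0,2,1] = (-1) * c [1,2,0,2,1,0] := by
    have r : c [1,0,1,0,2,2] + (c [1,0,2,0,1,2] + (c [1,0,2,0,2,1] + 0)) = 0 :=
      hs 1 2 [1,0,2,0,2,2] (by decide)
    linear_combination r - e49 - e15
  have e58 : c [2,1,2,1,0,0] = (-1) * c [0,1,2,2,0,1] := by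
    have r : c [2,2,1,1,0,0] + (c [2,1,2,1,0,0] + (c [2,1,1,2,0,0] + 0)) = 0 :=
      hs 2 1 [2,1,1,1,0,0] (by decide)
    linear_combination r - e26 - e37
  have e59 : c [1,1,2,0,0,2] = 0 := by
    have r : c [1,1,2,0,0,2] + (c [1,1,2,0,0,2] + (c [1,2,1,0,0,2] + (c [1,2,0,1,0,2] + (c [1,2,0,0,1,2] + (c [1,2,0,0,2,1] + 0))))) = 0 :=
      hd 1 [1,2,0,0,2]
    linear_combination (1 / 2) * (r - e36 - e55 - e17 - e5)
  have e60 : c [2,0,1,2,1,0] = (-1) * c [1,2,0,2,1,0] := by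
    have r : c [2,1,0,2,1,0] + (c [2,0,1,2,1,0] + (c [2,0,0,2,1,1] + 0)) = 0 :=
      hs 1 0 [2,0,0,2,1,0] (by decide)
    linear_combination r - e46 - e43
  have e61 : c [2,1,0,1,0,2] = c [1,2,0,2,1,0] := by
    have r : c [2,1,1,0,0,2] + (c [2,1,0,1,0,2] + (c [2,1,0,0,1,2] + 0)) = 0 :=
      hs 1 0 [2,1,0,0,0,2] (by decide)
    linear_combination r - e21 - e0
  have e62 : c [1,2,1,2,0,0] = c [0,1,2,2,0,1] := by
    have r : c [1,1,2,2,0,0] + (c [1,2,1,2,0,0] + (c [1,2,2,1,0,0] + 0)) = 0 :=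
      hs 1 2 [1,2,2,2,0,0] (by decide)
    linear_combination r - e7 - e48
  have e63 : c [2,0,1,2,0,1] = c [1,2,0,2,1,0] := by
    have r : c [2,1,1,2,0,0] + (c [2,0,1,2,1,0] + (c [2,0,1,2,0,1] + 0)) = 0 :=
      hs 1 0 [2,0,1,2,0,0] (by decide)
    linear_combination r - e37 - e60
  have e64 : c [0,1,1,0,2,2] = (2) * c [1,2,0,2,1,0] + (-1) * c [0,1,2,2,0,1] := by
    have r : c [2,2,0,1,1,0] + c [0,1,1,0,2,2] = 0 := hr [0,1,1,0,2,2] rfl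
    linear_combination r - e50
  have e65 : c [0,1,1,2,0,2] = (-1) * c [1,2,0,2,1,0] + (2) * c [0,1,2,2,0,1] := by
    have r : c [0,0,1,1,2,2] + (c [0,0,1,1,2,2] + (c [0,1,0,1,2,2] + (c [0,1,1,0,2,2] + (c [0,1,1,2,0,2] + (c [0,1,1,2,2,0] + 0))))) = 0 :=
      hd 0 [0,1,1,2,2]
    linear_combination r - 2 * e22 - e28 - e64 - e42
  have e66 : c [0,2,0,2,1,1] = (2) * c [1,2,0,2,1,0] + (-2) * c [0,1,2,2,0,1] := by
    have r : c [0,2,0,2,1,1] + (c [2,0,0,2,1,1] + (c [2,2,0,0,1,1] + 0)) = 0 :=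
      hs 0 2 [2,2,0,2,1,1] (by decide)
    linear_combination r - e43 - e23
  have e67 : c [1,0,1,2,0,2] = (-1) * c [1,2,0,2,1,0] + (-1) * c [0,1,2,2,0,1] := by
    have r : c [1,2,1,0,0,2] + (c [1,0,1,2,0,2] + (c [1,0,1,0,2,2] + 0)) = 0 :=
      hs 2 0 [1,0,1,0,0,2] (by decide)
    linear_combination r - e36 - e49
  have e68 : c [2,0,1,0,2,1] = (-1) * c [1,2,0,2,1,0] := by
    have r : c [2,1,0,0,2,1] + (c [2,0,1,0,2,1] + (c [2,0,0,1,2,1] + 0)) = 0 :=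
      hs 1 0 [2,0,0,0,2,1] (by decide)
    linear_combination r - e18 - e41
  have e69 : c [1,1,0,2,2,0] = 0 := by
    have r : c [1,1,0,2,2,0] + (c [0,1,1,2,2,0] + (c [0,1,0,2,2,1] + 0)) = 0 :=
      hs 1 0 [0,1,0,2,2,0] (by decide)
    linear_combination r - e42 - e10
  have e70 : c [1,1,2,0,2,0] = (2) * c [1,2,0,2,1,0] := by
    have r : c [1,1,2,0,2,0] + (c [1,0,2,1,2,0] + (c [1,0,2,0,2,1] + 0)) = 0 :=
      hs 1 0 [1,0,2,0,2,0] (by decide)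
    linear_combination r - e52 - e57
  have e71 : c [2,0,2,1,0,1] = (-1) * c [1,2,0,2,1,0] := by
    have r : c [1,0,2,2,0,1] + (c [2,0,1,2,0,1] + (c [2,0,2,1,0,1] + 0)) = 0 :=
      hs 1 2 [2,0,2,2,0,1] (by decide)
    linear_combination r - e1 - e63
  have e72 : c [0,2,2,1,0,1] = c [1,2,0,2,1,0] := by
    have r : c [0,2,2,1,0,1] + (c [1,2,2,0,0,1] + (c [1,2,2,1,0,0] + 0)) = 0 :=
      hs 0 1 [1,2,2,1,0,1] (by decide)
    linear_combination r - e39 - e48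
  have e73 : c [0,2,1,2,0,1] = (-1) * c [1,2,0,2,1,0] + (2) * c [0,1,2,2,0,1] := by
    have r : c [1,2,0,2,0,1] + (c [0,2,1,2,0,1] + (c [0,2,0,2,1,1] + 0)) = 0 :=
      hs 1 0 [0,2,0,2,0,1] (by decide)
    linear_combination r - e47 - e66
  have e74 : c [1,1,0,2,0,2] = (2) * c [1,2,0,2,1,0] := by
    have r : c [1,1,0,2,0,2] + (c [1,2,0,1,0,2] + (c [1,2,0,2,0,1] + 0)) = 0 :=
      hs 1 2 [1,2,0,2,0,2] (by decide)
    linear_combination r - e55 - e47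
  have e75 : c [0,1,2,0,1,2] = (-1) * c [1,2,0,2,1,0] := by
    have r : c [1,0,2,0,1,2] + (c [0,1,2,0,1,2] + (c [0,0,2,1,1,2] + 0)) = 0 :=
      hs 1 0 [0,0,2,0,1,2] (by decide)
    linear_combination r - e15 - e33
  have e76 : c [1,0,1,2,2,0] = c [1,2,0,2,1,0] + (-1) * c [0,1,2,2,0,1] := by
    have r : c [0,1,1,2,2,0] + (c [1,0,1,2,2,0] + (c [1,1,0,2,2,0] + 0)) = 0 :=
      hs 0 1 [1,1,1,2,2,0] (by decide)
    linear_combination r - e42 - e69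
  have e77 : c [2,0,0,1,1,2] = (-1) * c [1,2,0,2,1,0] := by
    have r : c [2,0,0,1,1,2] + (c [2,1,0,0,1,2] + (c [2,1,0,1,0,2] + 0)) = 0 :=
      hs 0 1 [2,1,0,1,1,2] (by decide)
    linear_combination r - e0 - e61
  have e78 : c [2,0,1,0,1,2] = c [1,2,0,2,1,0] := by
    have r : c [2,1,1,0,0,2] + (c [2,0,1,1,0,2] + (c [2,0,1,0,1,2] + 0)) = 0 :=
      hs 1 0 [2,0,1,0,0,2] (by decide)
    linear_combination r - e21 - e4
  have e79 : c [0,2,1,2,1,0] = (-1) * c [1,2,0,2,1,0] + (-1) * c [0,1,2,2,0,1] := by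
    have r : c [0,2,1,2,1,0] + (c [1,2,0,2,1,0] + (c [1,2,1,2,0,0] + 0)) = 0 :=
      hs 0 1 [1,2,1,2,1,0] (by decide)
    linear_combination r - e62
  have e80 : c [0,2,2,1,1,0] = 0 := by
    have r : c [1,0,2,2,1,0] + (c [0,1,2,2,1,0] + (c [0,2,1,2,1,0] + (c [0,2,2,1,1,0] + (c [0,2,2,1,1,0] + (c [0,2,2,1,0,1] + 0))))) = 0 :=
      hd 1 [0,2,2,1,0]
    linear_combination (1 / 2) * (r - e9 - e2 - e79 - e72)
  have e81 : c [0,2,0,1,1,2] = c [1,2,0,2,1,0] + c [0,1,2,2,0,1] := by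
    have r : c [0,2,0,1,1,2] + (c [1,2,0,0,1,2] + (c [1,2,0,1,0,2] + 0)) = 0 :=
      hs 0 1 [1,2,0,1,1,2] (by decide)
    linear_combination r - e17 - e55
  have e82 : c [2,0,2,0,1,1] = c [1,2,0,2,1,0] := by
    have r : c [1,2,0,2,0,1] + (c [2,1,0,2,0,1] + (c [2,0,1,2,0,1] + (c [2,0,2,1,0,1] + (c [2,0,2,0,1,1] + (c [2,0,2,0,1,1] + 0))))) = 0 :=
      hd 1 [2,0,2,0,1]
    linear_combination (1 / 2) * (r - e47 - e12 - e63 - e71)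
  have e83 : c [0,2,1,0,1,2] = (-1) * c [1,2,0,2,1,0] := by
    have r : c [0,2,1,0,1,2] + (c [2,0,1,0,1,2] + (c [2,2,1,0,1,0] + 0)) = 0 :=
      hs 0 2 [2,2,1,0,1,2] (by decide)
    linear_combination r - e78 - e25
  have e84 : c [0,1,2,1,0,2] = (-1) * c [1,2,0,2,1,0] := by
    have r : c [2,1,0,1,0,2] + (c [0,1,2,1,0,2] + (c [0,1,0,1,2,2] + 0)) = 0 :=
      hs 2 0 [0,1,0,1,0,2] (by decide)
    linear_combination r - e61 - e28
  have e85 : c [2,0,2,1,1,0] = 0 := by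
    have r : c [2,0,2,1,1,0] + (c [0,2,2,1,1,0] + (c [0,0,2,1,1,2] + 0)) = 0 :=
      hs 2 0 [0,0,2,1,1,0] (by decide)
    linear_combination r - e80 - e33
  have e86 : c [0,1,2,1,2,0] = c [1,2,0,2,1,0] + c [0,1,2,2,0,1] := by
    have r : c [0,1,2,1,2,0] + (c [2,1,0,1,2,0] + (c [2,1,2,1,0,0] + 0)) = 0 :=
      hs 0 2 [2,1,2,1,2,0] (by decide)
    linear_combination r - e53 - e58
  have e87 : c [0,2,2,0,1,1] = (-3/2) * c [0,1,2,2,0,1] := by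
    have r : c [1,0,2,2,0,1] + (c [0,1,2,2,0,1] + (c [0,2,1,2,0,1] + (c [0,2,2,1,0,1] + (c [0,2,2,0,1,1] + (c [0,2,2,0,1,1] + 0))))) = 0 :=
      hd 1 [0,2,2,0,1]
    linear_combination (1 / 2) * (r - e1 - e73 - e72)
  have p1 : c [0,1,2,2,0,1] = 0 := by
    have r : c [0,1,2,2,0,1] + c [1,0,2,2,1,0] = 0 := hr [1,0,2,2,1,0] rfl
    linear_combination (1/2) * (r - e9)
  have p0 : c [1,2,0,2,1,0] = 0 := by
    have r : c [1,2,1,0,0,2] + c [2,0,0,1,2,1] = 0 := hr [2,0,0,1,2,1] rfl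
    linear_combination (1/2) * (r - e41 - e36)
  simp only [words222, List.forall_mem_cons, List.not_mem_nil, false_imp_iff, implies_true,
    and_true, mul_zero, add_zero, p0, p1, e22, e20, e14, e33, e38, e8, e28, e51, e10, e64, e65,
    e42, e75, e6, e84, e86, e2, e81, e34, e66, e83, e45, e30, e3, e73, e79, e87, e72, e80, e29,
    e11, e35, e49, e67, e76, e15, e57, e44, e52, e1, e9, e24, e74, e69, e59, e70, e7, e17, e5,
    e55, e40, e47, e36, e31, e62, e39, e16, e48, e77, e41, e43, e78, e68, e4, e27, e63, e60, e82,
    e71, e85, e0, e18, e61, e53, e12, e46, e21, e54, e37, e13, e56, e58, e23, e32, e50, e19, e25,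
    e26]

lemma mem_words222 (a b c d e f : Fin 3)
    (h1 : (([a, b, c, d, e, f] : List (Fin 3)).map ![1, -1, 0]).sum = (0 : ℤ))
    (h2 : (([a, b, c, d, e, f] : List (Fin 3)).map ![0, 1, -1]).sum = (0 : ℤ)) :
    [a, b, c, d, e, f] ∈ words222 := by
  revert a b c d e f
  decide +kernel

/-- The words of content `(1,1,1)`. -/
def words111 : List (List (Fin 3)) :=
  [[0,1,2], [0,2,1], [1,0,2], [1,2,0], [2,0,1], [2,1,0]]

lemma mem_words111 (a b c : Fin 3)
    (h1 : (([a, b, c] : List (Fin 3)).map ![1, -1, 0]).sum = (0 : ℤ))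
    (h2 : (([a, b, c] : List (Fin 3)).map ![0, 1, -1]).sum = (0 : ℤ)) :
    [a, b, c] ∈ words111 := by
  revert a b c
  decide +kernel

lemma core3 (c : List (Fin 3) → ℂ)
    (hs : ∀ p q v, p ≠ q → ((subs p q v).map c).sum = 0)
    (hd : ∀ x v, ((ins x v).map c).sum = 0) : ∀ w ∈ words111, c w = 0 := by
  have r1 : c [1,0,2] + (c [0,1,2] + 0) = 0 := hs 1 0 [0,0,2] (by decide)
  have r2 : c [1,2,0] + (c [0,2,1] + 0) = 0 := hs 1 0 [0,2,0] (by decide)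
  have r3 : c [2,1,0] + (c [2,0,1] + 0) = 0 := hs 1 0 [2,0,0] (by decide)
  have r4 : c [2,1,0] + (c [1,2,0] + 0) = 0 := hs 2 1 [1,1,0] (by decide)
  have r5 : c [2,0,1] + (c [1,0,2] + 0) = 0 := hs 2 1 [1,0,1] (by decide)
  have r6 : c [0,1,2] + (c [1,0,2] + (c [1,2,0] + 0)) = 0 := hd 0 [1,2]
  have e1 : c [1,2,0] = 0 := by linear_combination r6 - r1
  have e2 : c [2,1,0] = 0 := by linear_combination r4 - e1
  have e3 : c [2,0,1] = 0 := by linear_combination r3 - e2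
  have e4 : c [1,0,2] = 0 := by linear_combination r5 - e3
  have e5 : c [0,1,2] = 0 := by linear_combination r1 - e4
  have e6 : c [0,2,1] = 0 := by linear_combination r2 - e1
  simp only [words111, List.forall_mem_cons, List.not_mem_nil, false_imp_iff, implies_true,
    and_true, e1, e2, e3, e4, e5, e6]

/-- For the natural representation of sl₃(ℂ) on the free Lie algebra on `a, b, c`,
there are no nonzero Lie invariants in degree 3 and none in degree 6. -/
theorem sl3_no_invariants_degree_three_and_six
    (X1 X2 X3 H1 H2 Y1 Y2 Y3 : LieDerivation ℂ FL FL)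
    (hX1a : X1 genA = 0) (hX1b : X1 genB = genA) (hX1c : X1 genC = 0)
    (hX2a : X2 genA = 0) (hX2b : X2 genB = 0) (hX2c : X2 genC = genB)
    (hX3a : X3 genA = 0) (hX3b : X3 genB = 0) (hX3c : X3 genC = genA)
    (hH1a : H1 genA = genA) (hH1b : H1 genB = -genB) (hH1c : H1 genC = 0)
    (hH2a : H2 genA = 0) (hH2b : H2 genB = genB) (hH2c : H2 genC = -genC)
    (hY1a : Y1 genA = genB) (hY1b : Y1 genB = 0) (hY1c : Y1 genC = 0)
    (hY2a : Y2 genA = 0) (hY2b : Y2 genB = genC) (hY2c : Y2 genC = 0)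
    (hY3a : Y3 genA = genC) (hY3b : Y3 genB = 0) (hY3c : Y3 genC = 0) :
    invariants3 X1 X2 X3 H1 H2 Y1 Y2 Y3 3 = ⊥ ∧
    invariants3 X1 X2 X3 H1 H2 Y1 Y2 Y3 6 = ⊥ := by
  have hE : ∀ (X : LieDerivation ℂ FL FL) (p q : Fin 3) (n : ℕ) (z : FL), z ∈ homog n → X z = 0 →
      (∀ i, emb (X (FreeLieAlgebra.of ℂ i)) = elem p q i) →
      ∀ v, ((subs p q v).map (cf (emb z))).sum = 0 := by
    intro X p q n z hz h0 h v
    rw [← cf_elem, ← emb_der_homog X _ h hz, h0, map_zero, cf_zero]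
  have hH : ∀ (X : LieDerivation ℂ FL FL) (s : Fin 3 → ℤ) (n : ℕ) (z : FL), z ∈ homog n → X z = 0 →
      (∀ i, emb (X (FreeLieAlgebra.of ℂ i)) = diag s i) →
      ∀ v, (v.map s).sum ≠ 0 → cf (emb z) v = 0 := by
    intro X s n z hz h0 h v hv
    have := cf_diag s (emb z) v
    rw [← emb_der_homog X _ h hz, h0, map_zero, cf_zero] at this
    exact (mul_eq_zero.1 this.symm).resolve_left (by exact_mod_cast hv)
  have hA : emb genA = wd [0] := emb_of 0
  have hB : emb genB = wd [1] := emb_of 1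
  have hC : emb genC = wd [2] := emb_of 2
  have main : ∀ (n : ℕ) (z : FL), z ∈ invariants3 X1 X2 X3 H1 H2 Y1 Y2 Y3 n →
      z ∈ homog n ∧ (∀ p q v, p ≠ q → ((subs p q v).map (cf (emb z))).sum = 0) ∧
      (∀ v, (v.map ![1, -1, 0]).sum ≠ (0 : ℤ) → cf (emb z) v = 0) ∧
      (∀ v, (v.map ![0, 1, -1]).sum ≠ (0 : ℤ) → cf (emb z) v = 0) := by
    intro n z hz
    simp only [invariants3, Submodule.mem_inf, LinearMap.mem_ker, LieDerivation.coeFn_coe] at hz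
    obtain ⟨⟨⟨⟨⟨⟨⟨⟨hz, z1⟩, z2⟩, z3⟩, z4⟩, z5⟩, z6⟩, z7⟩, z8⟩ := hz
    simp only [genA, genB, genC] at *
    refine ⟨hz, ?_, ?_, ?_⟩
    · intro p q v hpq
      fin_cases p <;> fin_cases q
      · exact absurd rfl hpq
      · exact hE Y1 0 1 n z hz z6 (by intro i; fin_cases i <;> simp [elem, *]) v
      · exact hE Y3 0 2 n z hz z8 (by intro i; fin_cases i <;> simp [elem, *]) v
      · exact hE X1 1 0 n z hz z1 (by intro i; fin_cases i <;> simp [elem, *]) v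
      · exact absurd rfl hpq
      · exact hE Y2 1 2 n z hz z7 (by intro i; fin_cases i <;> simp [elem, *]) v
      · exact hE X3 2 0 n z hz z3 (by intro i; fin_cases i <;> simp [elem, *]) v
      · exact hE X2 2 1 n z hz z2 (by intro i; fin_cases i <;> simp [elem, *]) v
      · exact absurd rfl hpq
    · exact hH H1 _ n z hz z4 (by intro i; fin_cases i <;> simp [diag, *])
    · exact hH H2 _ n z hz z5 (by intro i; fin_cases i <;> simp [diag, *])
  constructor
  · rw [Submodule.eq_bot_iff]
    intro z hz
    obtain ⟨hz, hs, h1, h2⟩ := main 3 z hz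
    refine emb_inj (by norm_num) hz fun l => ?_
    by_cases hl : l.length = 3
    swap
    · exact cf_length hz l hl
    by_cases k1 : (l.map ![1, -1, 0]).sum = (0 : ℤ)
    swap
    · exact h1 l k1
    by_cases k2 : (l.map ![0, 1, -1]).sum = (0 : ℤ)
    swap
    · exact h2 l k2
    refine core3 (cf (emb z)) hs (ins_zero (by norm_num) hz) l ?_
    match l, hl, k1, k2 with
    | [a, b, c], _, k1, k2 => exact mem_words111 a b c k1 k2
  · rw [Submodule.eq_bot_iff]
    intro z hz
    obtain ⟨hz, hs, h1, h2⟩ := main 6 z hz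
    refine emb_inj (by norm_num) hz fun l => ?_
    by_cases hl : l.length = 6
    swap
    · exact cf_length hz l hl
    by_cases k1 : (l.map ![1, -1, 0]).sum = (0 : ℤ)
    swap
    · exact h1 l k1
    by_cases k2 : (l.map ![0, 1, -1]).sum = (0 : ℤ)
    swap
    · exact h2 l k2
    refine core6 (cf (emb z)) ?_ hs (ins_zero (by norm_num) hz) l ?_
    · intro w hw
      have := cf_reverse hz w
      rw [hw] at this
      norm_num at this
      exact this
    match l, hl, k1, k2 with
    | [a, b, c, d, e, f], _, k1, k2 => exact mem_words222 a b c d e f k1 k2
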